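/- Let X be a median graph of dimension at most D and staircase length at most σ (D, σ natural numbers), let a group Γ act on X by graph automorphisms, and let s be an H-segment of length l ≥ 1 in X. Then the coboundary of the median quasimorphism f_s is bounded; more precisely, for all vertices x, y, z of X: |f_s(y,z) − f_s(x,z) + f_s(x,y)| ≤ 3·(l−1)·σ·D^l. In particular, f_s is a quasimorphism of the action Γ ↷ X. -/

import Mathlib

open scoped BigOperators

namespace MedianQM

variable {V : Type*}

/-- The interval `[x,y]`: vertices on geodesics from `x` to `y`. -/
def interval (X : SimpleGraph V) (x y : V) : Set V :=
  {m | X.dist x m + X.dist m y = X.dist x y}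

/-- A median graph: connected, and any three vertices admit a unique median. -/
def IsMedianGraph (X : SimpleGraph V) : Prop :=
  X.Connected ∧ ∀ x y z : V, ∃! m : V,
    m ∈ interval X x y ∧ m ∈ interval X y z ∧ m ∈ interval X x z

/-- A halfspace of `X`: the set of vertices strictly closer to one endpoint of
an edge than to the other. -/
def IsHalfspace (X : SimpleGraph V) (h : Set V) : Prop :=
  ∃ a b : V, X.Adj a b ∧ h = {v | X.dist v a < X.dist v b}

/-- The edge `{a,b}` is dual to the halfspace `h` (equivalently, to the
hyperplane `{h, h̄}`). -/
def EdgeDual (X : SimpleGraph V) (h : Set V) (a b : V) : Prop :=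
  X.Adj a b ∧
    (h = {v | X.dist v a < X.dist v b} ∨ h = {v | X.dist v b < X.dist v a})

/-- Two halfspaces are transverse. -/
def Transv (h k : Set V) : Prop :=
  (h ∩ k).Nonempty ∧ (hᶜ ∩ k).Nonempty ∧ (h ∩ kᶜ).Nonempty ∧ (hᶜ ∩ kᶜ).Nonempty

/-- `[x,y]_H`: the set of halfspaces separating `y` from `x`. -/
def sepH (X : SimpleGraph V) (x y : V) : Set (Set V) :=
  {h | IsHalfspace X h ∧ y ∈ h ∧ x ∉ h}

/-- `X` has dimension at most `D`: every (finite) family of pairwise transverse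
halfspaces has at most `D` elements. -/
def DimLE (X : SimpleGraph V) (D : ℕ) : Prop :=
  ∀ S : Finset (Set V), (∀ h ∈ S, IsHalfspace X h) →
    (∀ h ∈ S, ∀ k ∈ S, h ≠ k → Transv h k) → S.card ≤ D

/-- `h ⊋ k` are tightly nested: no halfspace lies strictly between them. -/
def TightlyNested (X : SimpleGraph V) (h k : Set V) : Prop :=
  k ⊂ h ∧ ¬ ∃ h' : Set V, IsHalfspace X h' ∧ h' ⊂ h ∧ k ⊂ h'

/-- A staircase of length `n`. -/
def IsStaircase (X : SimpleGraph V) (n : ℕ) (h k : Fin n → Set V) : Prop :=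
  (∀ i, IsHalfspace X (h i)) ∧ (∀ i, IsHalfspace X (k i)) ∧
  (∀ i j : Fin n, i < j → h j ⊂ h i) ∧ (∀ i j : Fin n, i < j → k j ⊂ k i) ∧
  (∀ i, k i ⊂ h i) ∧ (∀ i j : Fin n, j < i → Transv (h i) (k j))

/-- `X` has staircase length at most `σ`: there is no staircase of length `σ+1`. -/
def StaircaseLE (X : SimpleGraph V) (σ : ℕ) : Prop :=
  ∀ h k : Fin (σ + 1) → Set V, ¬ IsStaircase X (σ + 1) h k

/-- An `H`-segment of length `l`: a tuple of consecutively tightly nested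
halfspaces `h₁ ⊋ ⋯ ⊋ h_l`. -/
def IsHSegment (X : SimpleGraph V) (l : ℕ) (s : Fin l → Set V) : Prop :=
  (∀ i, IsHalfspace X (s i)) ∧
  ∀ i j : Fin l, (j : ℕ) = (i : ℕ) + 1 → TightlyNested X (s i) (s j)

/-- The segment `t` is contained in `[x,y]_H`. -/
def SegIn (X : SimpleGraph V) (x y : V) {l : ℕ} (t : Fin l → Set V) : Prop :=
  ∀ i, t i ∈ sepH X x y

/-- The translate of a segment by a group element. -/
def segSMul {Γ : Type*} [SMul Γ V] (γ : Γ) {l : ℕ} (s : Fin l → Set V) :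
    Fin l → Set V :=
  fun i => (γ • ·) '' s i

/-- The set of translates of `s` contained in `[x,y]_H`. -/
def translatesIn (X : SimpleGraph V) (Γ : Type*) [SMul Γ V] {l : ℕ}
    (s : Fin l → Set V) (x y : V) : Set (Fin l → Set V) :=
  {t | (∃ γ : Γ, t = segSMul γ s) ∧ SegIn X x y t}

/-- The median quasimorphism of the segment `s` (for the action of `Γ` on `X`). -/
noncomputable def fs (X : SimpleGraph V) (Γ : Type*) [SMul Γ V] {l : ℕ}
    (s : Fin l → Set V) (x y : V) : ℝ :=
  ((translatesIn X Γ s x y).ncard : ℝ) - ((translatesIn X Γ s y x).ncard : ℝ)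

/-- The coboundary of a function of two variables, evaluated on a triple. -/
noncomputable def d1 (f : V → V → ℝ) (x y z : V) : ℝ := f y z - f x z + f x y

/-- The simplicial coboundary operator. -/
noncomputable def cob {W : Type*} {m : ℕ} (β : (Fin (m + 1) → W) → ℝ) :
    (Fin (m + 2) → W) → ℝ :=
  fun x => ∑ j : Fin (m + 2), (-1 : ℝ) ^ (j : ℕ) * β (fun i => x (j.succAbove i))

/-- Γ-invariance of a cochain. -/
def IsInvariant (Γ : Type*) {W : Type*} [SMul Γ W] {m : ℕ}
    (β : (Fin m → W) → ℝ) : Prop :=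
  ∀ (γ : Γ) (x : Fin m → W), β (fun i => γ • x i) = β x

/-- Boundedness of a real-valued function. -/
def IsBounded {α : Type*} (β : α → ℝ) : Prop := ∃ C : ℝ, ∀ x, |β x| ≤ C

/-- A head of the segment `s`. -/
def IsHead (X : SimpleGraph V) {l : ℕ} (hl : 0 < l) (s : Fin l → Set V)
    (a : V) : Prop :=
  a ∉ s ⟨0, hl⟩ ∧ ∃ b, EdgeDual X (s ⟨0, hl⟩) a b

/-- A tail of the segment `s`. -/
def IsTail (X : SimpleGraph V) {l : ℕ} (hl : 0 < l) (s : Fin l → Set V)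
    (a : V) : Prop :=
  a ∈ s ⟨l - 1, by omega⟩ ∧ ∃ b, EdgeDual X (s ⟨l - 1, by omega⟩) a b

/-- The cochain `κ` is non-transverse to the segment `s`. -/
def NonTransverseTo (X : SimpleGraph V) {n l : ℕ} (hl : 0 < l)
    (κ : (Fin (n + 1) → V) → ℝ) (s : Fin l → Set V) : Prop :=
  (∀ (x : Fin n → V) (a a' : V), IsHead X hl s a → IsHead X hl s a' →
    κ (Fin.cons a x) = κ (Fin.cons a' x)) ∧
  (∀ (x : Fin n → V) (a a' : V), IsTail X hl s a → IsTail X hl s a' →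
    κ (Fin.cons a x) = κ (Fin.cons a' x))

/-- The action of `Γ` on `X` is by graph automorphisms. -/
def ActsOn (Γ : Type*) [SMul Γ V] (X : SimpleGraph V) : Prop :=
  ∀ (γ : Γ) (a b : V), X.Adj a b → X.Adj (γ • a) (γ • b)

theorem IsMedianGraph.exists_median {X : SimpleGraph V} (hX : IsMedianGraph X) (x y z : V) :
    ∃ m, X.dist x m + X.dist m y = X.dist x y ∧ X.dist y m + X.dist m z = X.dist y z ∧
      X.dist x m + X.dist m z = X.dist x z :=
  (hX.2 x y z).exists

theorem IsMedianGraph.median_unique {X : SimpleGraph V} (hX : IsMedianGraph X) {x y z m m' : V}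
    (h₁ : X.dist x m + X.dist m y = X.dist x y) (h₂ : X.dist y m + X.dist m z = X.dist y z)
    (h₃ : X.dist x m + X.dist m z = X.dist x z)
    (h₁' : X.dist x m' + X.dist m' y = X.dist x y)
    (h₂' : X.dist y m' + X.dist m' z = X.dist y z)
    (h₃' : X.dist x m' + X.dist m' z = X.dist x z) : m = m' :=
  (hX.2 x y z).unique ⟨h₁, h₂, h₃⟩ ⟨h₁', h₂', h₃'⟩

/-- Distances to the endpoints of an edge differ by exactly one. -/
theorem IsMedianGraph.dist_adj {X : SimpleGraph V} (hX : IsMedianGraph X) {a b : V}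
    (hab : X.Adj a b) (v : V) :
    X.dist v a = X.dist v b + 1 ∨ X.dist v b = X.dist v a + 1 := by
  have hd : X.dist a b = 1 := SimpleGraph.dist_eq_one_iff_adj.2 hab
  have hd' : X.dist b a = 1 := SimpleGraph.dist_eq_one_iff_adj.2 hab.symm
  obtain ⟨m, h₁, h₂, h₃⟩ := hX.exists_median a b v
  rw [X.dist_comm (u := v) (v := a), X.dist_comm (u := v) (v := b)]
  rcases Nat.eq_zero_or_pos (X.dist a m) with h | h
  · have : a = m := hX.1.dist_eq_zero_iff.1 h
    subst this
    omega
  · have : m = b := hX.1.dist_eq_zero_iff.1 (by omega)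
    subst this
    omega

theorem exists_adj_dist_eq {X : SimpleGraph V} (hX : X.Connected) {u v : V} {n : ℕ}
    (h : X.dist u v = n + 1) : ∃ w, X.Adj u w ∧ X.dist w v = n := by
  obtain ⟨p, hp⟩ := hX.exists_walk_length_eq_dist u v
  cases p with
  | nil => simp at h
  | @cons _ w _ hadj q =>
    refine ⟨w, hadj, le_antisymm ?_ ?_⟩
    · have := X.dist_le q
      simp only [SimpleGraph.Walk.length_cons] at hp
      omega
    · have := hX.dist_triangle (u := u) (v := w) (w := v)
      rw [SimpleGraph.dist_eq_one_iff_adj.2 hadj] at this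
      omega

/-- Opposite edges of a square determine the same halfspaces. -/
theorem IsMedianGraph.square {X : SimpleGraph V} (hX : IsMedianGraph X) {u v w t p : V}
    (huv : X.Adj u v) (hvw : X.Adj v w) (hwt : X.Adj w t) (htu : X.Adj t u)
    (huw : u ≠ w) (h : X.dist p t < X.dist p w) (hvt : v ≠ t) : X.dist p u < X.dist p v := by
  by_contra hcon
  -- now `v` and `t` are both closer to `p` than `u` and `w`
  have e₁ := hX.dist_adj huv p
  have e₂ := hX.dist_adj hvw p
  have e₃ := hX.dist_adj hwt p
  have e₄ := hX.dist_adj htu p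
  have d2 : X.dist u w = 2 := by
    have h1 := hX.1.dist_triangle (u := u) (v := v) (w := w)
    rw [SimpleGraph.dist_eq_one_iff_adj.2 huv, SimpleGraph.dist_eq_one_iff_adj.2 hvw] at h1
    have h2 := hX.1.pos_dist_of_ne huw
    have h3 := hX.dist_adj hvw u
    rw [SimpleGraph.dist_eq_one_iff_adj.2 huv] at h3
    omega
  refine hvt (hX.median_unique (x := u) (y := w) (z := p) ?_ ?_ ?_ ?_ ?_ ?_)
  all_goals
    simp only [X.dist_comm (v := p), d2, SimpleGraph.dist_eq_one_iff_adj.2 huv,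
      SimpleGraph.dist_eq_one_iff_adj.2 hvw, SimpleGraph.dist_eq_one_iff_adj.2 hvw.symm,
      SimpleGraph.dist_eq_one_iff_adj.2 hwt, SimpleGraph.dist_eq_one_iff_adj.2 hwt.symm,
      SimpleGraph.dist_eq_one_iff_adj.2 htu.symm]
  all_goals omega

theorem IsMedianGraph.halfspace_aux {X : SimpleGraph V} (hX : IsMedianGraph X) {a b : V}
    (hab : X.Adj a b) (n : ℕ) : ∀ u v : V, X.Adj u v → X.dist u a = n → X.dist v b = n →
    X.dist u b = n + 1 → X.dist v a = n + 1 → ∀ p, X.dist p a < X.dist p b ↔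
      X.dist p u < X.dist p v := by
  induction n with
  | zero =>
    intro u v _ h1 h2 _ _ p
    rw [hX.1.dist_eq_zero_iff.1 h1, hX.1.dist_eq_zero_iff.1 h2]
  | succ n ih =>
    intro u v huv h1 h2 h3 h4 p
    obtain ⟨t, hut, ht⟩ := exists_adj_dist_eq hX.1 h1
    have htv : t ≠ v := by rintro rfl; omega
    have htb : X.dist t b = n + 1 := by
      have := hX.dist_adj hut b
      have := hX.dist_adj hab t
      simp only [X.dist_comm (u := b)] at *
      omega
    have dtv : X.dist t v = 2 := by
      have e1 := hX.1.dist_triangle (u := t) (v := u) (w := v)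
      rw [SimpleGraph.dist_eq_one_iff_adj.2 huv, SimpleGraph.dist_eq_one_iff_adj.2 hut.symm] at e1
      have e2 := hX.1.pos_dist_of_ne htv
      have e3 := hX.dist_adj huv t
      rw [SimpleGraph.dist_eq_one_iff_adj.2 hut.symm] at e3
      omega
    obtain ⟨w, m1, m2, m3⟩ := hX.exists_median t v b
    have htw : X.Adj t w := SimpleGraph.dist_eq_one_iff_adj.1 (by
      simp only [X.dist_comm (u := v) (v := w)] at *; omega)
    have hvw : X.Adj v w := SimpleGraph.dist_eq_one_iff_adj.1 (by
      simp only [X.dist_comm (u := v) (v := w)] at *; omega)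
    have dtw := SimpleGraph.dist_eq_one_iff_adj.2 htw
    have hwb : X.dist w b = n := by omega
    have hwa : X.dist w a = n + 1 := by
      have e1 := hX.dist_adj hvw a
      have e2 := hX.dist_adj hab w
      simp only [X.dist_comm (u := a)] at *
      omega
    rw [ih t w htw ht hwb htb hwa p]
    have huw : u ≠ w := by rintro rfl; omega
    constructor
    · intro h
      exact hX.square huv hvw htw.symm hut.symm huw h htv.symm
    · intro h
      exact hX.square htw hvw.symm huv.symm hut htv h huw.symm

/-- A halfspace is determined by any edge crossing it. -/
theorem IsMedianGraph.halfspace_eq {X : SimpleGraph V} (hX : IsMedianGraph X) {h : Set V}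
    (hh : IsHalfspace X h) {u v : V} (huv : X.Adj u v) (hu : u ∈ h) (hv : v ∉ h) :
    h = {p | X.dist p u < X.dist p v} := by
  obtain ⟨a, b, hab, rfl⟩ := hh
  simp only [Set.mem_ofPred_eq, not_lt] at hu hv
  have e1 := hX.dist_adj hab u
  have e2 := hX.dist_adj hab v
  have e3 := hX.dist_adj huv a
  have e4 := hX.dist_adj huv b
  simp only [X.dist_comm (u := a), X.dist_comm (u := b)] at e3 e4
  ext p
  exact hX.halfspace_aux hab (X.dist u a) u v huv rfl (by omega) (by omega) (by omega) p

theorem IsMedianGraph.isHalfspace_compl {X : SimpleGraph V} (hX : IsMedianGraph X) {h : Set V}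
    (hh : IsHalfspace X h) : IsHalfspace X hᶜ := by
  obtain ⟨a, b, hab, rfl⟩ := hh
  refine ⟨b, a, hab.symm, ?_⟩
  ext p
  have := hX.dist_adj hab p
  simp only [Set.mem_compl_iff, Set.mem_ofPred_eq]
  omega

/-- Halfspaces are convex. -/
theorem IsMedianGraph.mem_halfspace_of_between {X : SimpleGraph V} (hX : IsMedianGraph X)
    {h : Set V} (hh : IsHalfspace X h) {x y m : V} (hx : x ∈ h) (hy : y ∈ h)
    (hm : X.dist x m + X.dist m y = X.dist x y) : m ∈ h := by
  induction hn : X.dist x m generalizing x with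
  | zero => rwa [← hX.1.dist_eq_zero_iff.1 hn]
  | succ n ih =>
    obtain ⟨x', hadj, hd⟩ := exists_adj_dist_eq hX.1 hn
    have e1 := hX.1.dist_triangle (u := x') (v := m) (w := y)
    have e2 := hX.1.dist_triangle (u := x) (v := x') (w := y)
    rw [SimpleGraph.dist_eq_one_iff_adj.2 hadj] at e2
    by_cases hx' : x' ∈ h
    · exact ih hx' (by omega) hd
    · rw [hX.halfspace_eq hh hadj hx hx', Set.mem_ofPred_eq] at hy
      rw [X.dist_comm (u := y), X.dist_comm (u := y)] at hy
      omega

theorem IsMedianGraph.finite_sepH {X : SimpleGraph V} (hX : IsMedianGraph X) (x y : V) :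
    (sepH X x y).Finite := by
  obtain ⟨p⟩ := hX.1 x y
  induction p with
  | nil => exact Set.finite_empty.subset fun h hh => hh.2.2 hh.2.1
  | @cons u v w hadj q ih =>
    refine (ih.union (Set.finite_singleton {p | X.dist p v < X.dist p u})).subset ?_
    rintro h ⟨hh, hy, hx⟩
    by_cases hv : v ∈ h
    · exact Or.inr (hX.halfspace_eq hh hadj.symm hv hx)
    · exact Or.inl ⟨hh, hy, hv⟩

theorem IsMedianGraph.sepH_eq_union {X : SimpleGraph V} (hX : IsMedianGraph X) {x y m : V}
    (hm : X.dist x m + X.dist m y = X.dist x y) : sepH X x y = sepH X x m ∪ sepH X m y := by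
  ext h
  constructor
  · rintro ⟨hh, hy, hx⟩
    by_cases hmh : m ∈ h
    · exact Or.inl ⟨hh, hmh, hx⟩
    · exact Or.inr ⟨hh, hy, hmh⟩
  · rintro (⟨hh, hmh, hx⟩ | ⟨hh, hy, hmh⟩)
    · refine ⟨hh, ?_, hx⟩
      by_contra hy
      exact hX.mem_halfspace_of_between (hX.isHalfspace_compl hh) hx hy hm hmh
    · refine ⟨hh, hy, ?_⟩
      intro hx
      exact hmh (hX.mem_halfspace_of_between hh hx hy hm)

/-- **Dilworth's theorem**: a finite set without antichains of more than `k` elements is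
covered by `k` chains, here given as the classes of a colouring. -/
theorem exists_chain_coloring {α : Type*} [PartialOrder α] (P : Finset α) :
    ∀ k : ℕ, (∀ A ⊆ P, IsAntichain (· ≤ ·) (A : Set α) → A.card ≤ k) →
    ∃ c : α → ℕ, (∀ a ∈ P, c a < k) ∧ ∀ a ∈ P, ∀ b ∈ P, c a = c b → a ≤ b ∨ b ≤ a := by
  classical
  induction P using Finset.strongInduction with
  | H P ih =>
  intro k hk
  rcases P.eq_empty_or_nonempty with rfl | hne
  · exact ⟨fun _ => 0, by simp, by simp⟩
  obtain ⟨a, ha⟩ := P.exists_maximal hne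
  have haP : a ∈ P := ha.prop
  have hk1 : 1 ≤ k := by
    have := hk {a} (by simpa using haP) (by simp)
    simpa using this
  -- Removing a chain that meets every antichain of size `k` allows induction.
  have extend : ∀ K : Finset α, a ∈ K → (∀ x ∈ K, ∀ y ∈ K, x ≤ y ∨ y ≤ x) →
      (∀ A ⊆ P \ K, IsAntichain (· ≤ ·) (A : Set α) → A.card ≠ k) →
      ∃ c : α → ℕ, (∀ a ∈ P, c a < k) ∧ ∀ a ∈ P, ∀ b ∈ P, c a = c b → a ≤ b ∨ b ≤ a := by
    intro K haK hK hA
    have hss : P \ K ⊂ P := by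
      refine Finset.ssubset_iff_of_subset Finset.sdiff_subset |>.2 ⟨a, haP, by simp [haK]⟩
    obtain ⟨c, hc, hcc⟩ := ih (P \ K) hss (k - 1) (fun A hAP hanti => by
      have h1 := hk A (hAP.trans Finset.sdiff_subset) hanti
      have h2 := hA A hAP hanti
      omega)
    refine ⟨fun x => if x ∈ K then k - 1 else c x, ?_, ?_⟩
    · intro x hx
      by_cases hxK : x ∈ K
      · simp only [hxK, if_true]; omega
      · have := hc x (by simp [hx, hxK])
        simp only [hxK, if_false]; omega
    · intro x hx y hy hxy
      by_cases hxK : x ∈ K <;> by_cases hyK : y ∈ K <;> simp only [hxK, hyK, if_true, if_false] at hxy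
      · exact hK x hxK y hyK
      · have := hc y (by simp [hy, hyK]); omega
      · have := hc x (by simp [hx, hxK]); omega
      · exact hcc x (by simp [hx, hxK]) y (by simp [hy, hyK]) hxy
  by_cases hex : ∃ A ⊆ P.erase a, IsAntichain (· ≤ ·) (A : Set α) ∧ A.card = k
  swap
  · refine extend {a} (by simp) (by simp) fun A hA hanti hcard => hex ⟨A, ?_, hanti, hcard⟩
    rwa [← Finset.sdiff_singleton_eq_erase]
  obtain ⟨A₀, hA₀, hA₀anti, hA₀card⟩ := hex
  obtain ⟨c, hc, hcc⟩ := ih (P.erase a) (Finset.erase_ssubset haP) k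
    (fun A hA => hk A (hA.trans (Finset.erase_subset _ _)))
  have hsurj : ∀ A ⊆ P.erase a, IsAntichain (· ≤ ·) (A : Set α) → A.card = k →
      ∀ i < k, ∃ y ∈ A, c y = i := by
    intro A hA hanti hcard i hi
    have hinj : Set.InjOn c (A : Set α) := by
      intro x hx y hy hxy
      by_contra hne
      rcases hcc x (hA hx) y (hA hy) hxy with h | h
      · exact hanti hx hy hne h
      · exact hanti hy hx (Ne.symm hne) h
    have himg : A.image c = Finset.range k := by
      apply Finset.eq_of_subset_of_card_le
      · intro j hj
        obtain ⟨y, hy, rfl⟩ := Finset.mem_image.1 hj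
        exact Finset.mem_range.2 (hc y (hA hy))
      · rw [Finset.card_image_of_injOn hinj, hcard, Finset.card_range]
    have : i ∈ A.image c := by rw [himg]; exact Finset.mem_range.2 hi
    simpa using this
  let S : Finset α := (P.erase a).filter fun x =>
    ∃ A ⊆ P.erase a, IsAntichain (· ≤ ·) (A : Set α) ∧ A.card = k ∧ x ∈ A
  have htop : ∀ i < k, ∃ x ∈ S, c x = i ∧ ∀ y ∈ S, c y = i → y ≤ x := by
    intro i hi
    obtain ⟨y, hy, hyi⟩ := hsurj A₀ hA₀ hA₀anti hA₀card i hi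
    obtain ⟨x, hx⟩ := (S.filter fun x => c x = i).exists_maximal
      ⟨y, Finset.mem_filter.2 ⟨Finset.mem_filter.2
        ⟨hA₀ hy, A₀, hA₀, hA₀anti, hA₀card, hy⟩, hyi⟩⟩
    obtain ⟨hxS, hxi⟩ := Finset.mem_filter.1 hx.prop
    refine ⟨x, hxS, hxi, fun z hz hzi => ?_⟩
    rcases hcc x (Finset.mem_filter.1 hxS).1 z (Finset.mem_filter.1 hz).1 (hxi.trans hzi.symm)
      with h | h
    · exact hx.le_of_ge (Finset.mem_filter.2 ⟨hz, hzi⟩) h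
    · exact h
  have : Nonempty α := ⟨a⟩
  choose! x hxS hxc hxtop using htop
  have hxanti : ∀ i < k, ∀ j < k, i ≠ j → ¬ x j ≤ x i := by
    intro i hi j hj hij hle
    obtain ⟨-, A, hA, hanti, hcard, hxA⟩ := Finset.mem_filter.1 (hxS i hi)
    obtain ⟨y, hy, hyj⟩ := hsurj A hA hanti hcard j hj
    have hyx : y ≤ x j := hxtop j hj y
      (Finset.mem_filter.2 ⟨hA hy, A, hA, hanti, hcard, hy⟩) hyj
    by_cases hne : y = x i
    · apply hij
      rw [← hyj, hne, hxc i hi]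
    · exact hanti hy hxA hne (hyx.trans hle)
  have hxP : ∀ i < k, x i ∈ P.erase a := fun i hi => (Finset.mem_filter.1 (hxS i hi)).1
  have hlt : ∃ i < k, x i ≤ a := by
    by_contra! hno
    have hnot : a ∉ (Finset.range k).image x := by
      intro h
      obtain ⟨i, hi, hia⟩ := Finset.mem_image.1 h
      exact (Finset.mem_erase.1 (hxP i (Finset.mem_range.1 hi))).1 hia
    have hno' : ∀ i < k, ¬ a ≤ x i := fun i hi hle =>
      hno i hi (ha.le_of_ge (Finset.mem_of_mem_erase (hxP i hi)) hle)
    have hcard := hk (insert a ((Finset.range k).image x)) (by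
      intro y hy
      rcases Finset.mem_insert.1 hy with rfl | hy
      · exact haP
      · obtain ⟨i, hi, rfl⟩ := Finset.mem_image.1 hy
        exact Finset.mem_of_mem_erase (hxP i (Finset.mem_range.1 hi))) (by
      intro y hy z hz hne hle
      simp only [Finset.coe_insert, Finset.coe_image, Finset.coe_range, Set.mem_insert_iff,
        Set.mem_image, Set.mem_Iio] at hy hz
      rcases hy with rfl | ⟨i, hi, rfl⟩ <;> rcases hz with rfl | ⟨j, hj, rfl⟩
      · exact hne rfl
      · exact hno' j hj hle
      · exact hno i hi hle
      · exact hxanti j hj i hi (fun h => hne (by rw [h])) hle)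
    rw [Finset.card_insert_of_notMem hnot, Finset.card_image_of_injOn, Finset.card_range] at hcard
    · omega
    · intro i hi j hj hij
      simp only [Finset.coe_range, Set.mem_Iio] at hi hj
      rw [← hxc i hi, ← hxc j hj, hij]
  obtain ⟨i, hi, hia⟩ := hlt
  refine extend (insert a ((P.erase a).filter fun z => c z = i ∧ z ≤ x i)) (by simp) ?_ ?_
  · intro y hy z hz
    rcases Finset.mem_insert.1 hy with rfl | hy <;> rcases Finset.mem_insert.1 hz with rfl | hz
    · exact Or.inl le_rfl
    · exact Or.inr ((Finset.mem_filter.1 hz).2.2.trans hia)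
    · exact Or.inl ((Finset.mem_filter.1 hy).2.2.trans hia)
    · obtain ⟨hy, hyc, -⟩ := Finset.mem_filter.1 hy
      obtain ⟨hz, hzc, -⟩ := Finset.mem_filter.1 hz
      exact hcc y hy z hz (hyc.trans hzc.symm)
  · intro A hA hanti hcard
    have hAP : A ⊆ P.erase a := by
      intro y hy
      have := Finset.mem_sdiff.1 (hA hy)
      exact Finset.mem_erase.2 ⟨fun h => this.2 (by simp [h]), this.1⟩
    obtain ⟨y, hy, hyi⟩ := hsurj A hAP hanti hcard i hi
    refine (Finset.mem_sdiff.1 (hA hy)).2 (Finset.mem_insert_of_mem (Finset.mem_filter.2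
      ⟨hAP hy, hyi, hxtop i hi y ?_ hyi⟩))
    exact Finset.mem_filter.2 ⟨hAP hy, A, hAP, hanti, hcard, hy⟩

theorem exists_strictAnti_of_chain {α : Type*} [PartialOrder α] (A : Finset α)
    (hA : ∀ a ∈ A, ∀ b ∈ A, a ≤ b ∨ b ≤ a) {n : ℕ} (hn : n ≤ A.card) :
    ∃ f : Fin n → α, StrictAnti f ∧ ∀ i, f i ∈ A := by
  classical
  let : LinearOrder A :=
    { (inferInstance : PartialOrder A) with
      le_total := fun a b => hA a a.2 b b.2
      toDecidableLE := Classical.decRel _ }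
  have hcard : n ≤ (Finset.univ : Finset A).card := by simpa using hn
  let e := (Finset.univ : Finset A).orderEmbOfCardLe hcard
  refine ⟨fun i => (e (Fin.rev i) : A), ?_, fun i => (e (Fin.rev i)).2⟩
  intro i j hij
  have : e (Fin.rev j) < e (Fin.rev i) := e.strictMono (Fin.rev_lt_rev.2 hij)
  exact this

theorem TightlyNested.right_unique {X : SimpleGraph V} {h k k' : Set V}
    (hk : TightlyNested X h k) (hk' : TightlyNested X h k') (h₁ : IsHalfspace X k)
    (h₂ : IsHalfspace X k') (hc : k ⊆ k' ∨ k' ⊆ k) : k = k' := by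
  by_contra hne
  rcases hc with hc | hc
  · exact hk.2 ⟨k', h₂, hk'.1, hc.ssubset_of_ne hne⟩
  · exact hk'.2 ⟨k, h₁, hk.1, hc.ssubset_of_ne (Ne.symm hne)⟩

theorem TightlyNested.left_unique {X : SimpleGraph V} {h h' k : Set V}
    (hk : TightlyNested X h k) (hk' : TightlyNested X h' k) (h₁ : IsHalfspace X h)
    (h₂ : IsHalfspace X h') (hc : h ⊆ h' ∨ h' ⊆ h) : h = h' := by
  by_contra hne
  rcases hc with hc | hc
  · exact hk'.2 ⟨h, h₁, hc.ssubset_of_ne hne, hk.1⟩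
  · exact hk.2 ⟨h', h₂, hc.ssubset_of_ne (Ne.symm hne), hk'.1⟩

theorem IsHSegment.subset {X : SimpleGraph V} {l : ℕ} {t : Fin l → Set V}
    (ht : IsHSegment X l t) {i j : Fin l} (hij : i ≤ j) : t j ⊆ t i := by
  obtain ⟨j, hj⟩ := j
  induction j with
  | zero =>
    rw [show i = ⟨0, hj⟩ from Fin.ext (Nat.le_zero.1 hij)]
  | succ j ih =>
    rcases Nat.lt_or_ge i.1 (j + 1) with h | h
    · exact (ht.2 ⟨j, by omega⟩ ⟨j + 1, hj⟩ rfl).1.subset.trans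
        (ih (by omega) (Nat.lt_succ_iff.1 h))
    · rw [show i = ⟨j + 1, hj⟩ from Fin.ext (le_antisymm hij h)]

/-- Segments whose corresponding members are comparable agree as soon as they share a member. -/
theorem IsHSegment.eq_of_apply_eq {X : SimpleGraph V} {l : ℕ} {t t' : Fin l → Set V}
    (ht : IsHSegment X l t) (ht' : IsHSegment X l t') (hc : ∀ i, t i ⊆ t' i ∨ t' i ⊆ t i)
    (i : Fin l) (hi : t i = t' i) : t = t' := by
  have up : ∀ n, ∀ hn : i.1 + n < l, t ⟨i.1 + n, hn⟩ = t' ⟨i.1 + n, hn⟩ := by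
    intro n
    induction n with
    | zero => exact fun _ => hi
    | succ n ih =>
      intro hn
      have h₁ := ht.2 ⟨i.1 + n, by omega⟩ ⟨i.1 + (n + 1), hn⟩ rfl
      have h₂ := ht'.2 ⟨i.1 + n, by omega⟩ ⟨i.1 + (n + 1), hn⟩ rfl
      rw [← ih (by omega)] at h₂
      exact h₁.right_unique h₂ (ht.1 _) (ht'.1 _) (hc _)
  have down : ∀ n, ∀ hn : i.1 - n < l, t ⟨i.1 - n, hn⟩ = t' ⟨i.1 - n, hn⟩ := by
    intro n
    induction n with
    | zero => exact fun _ => hi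
    | succ n ih =>
      intro hn
      rcases Nat.lt_or_ge n i.1 with h | h
      · have h₁ := ht.2 ⟨i.1 - (n + 1), hn⟩ ⟨i.1 - n, by omega⟩ (by simp only; omega)
        have h₂ := ht'.2 ⟨i.1 - (n + 1), hn⟩ ⟨i.1 - n, by omega⟩ (by simp only; omega)
        rw [← ih (by omega)] at h₂
        exact h₁.left_unique h₂ (ht.1 _) (ht'.1 _) (hc _)
      · have e : (⟨i.1 - (n + 1), hn⟩ : Fin l) = ⟨i.1 - n, by omega⟩ := Fin.ext (by
          simp only; omega)
        rw [e]
        exact ih _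
  funext j
  rcases le_total i.1 j.1 with h | h
  · have := up (j.1 - i.1) (by omega)
    simpa only [Nat.add_sub_cancel' h] using this
  · have := down (i.1 - j.1) (by omega)
    simpa only [Nat.sub_sub_self h] using this

/-- A segment having a vertex in its interior passes that vertex at a definite step. -/
theorem IsHSegment.exists_crossing {X : SimpleGraph V} {l : ℕ} {t : Fin l → Set V}
    (ht : IsHSegment X l t) {m : V} (h₁ : ∃ i, m ∈ t i) (h₂ : ∃ i, m ∉ t i) :
    ∃ (p : ℕ) (hp : p + 1 < l), m ∈ t ⟨p, by omega⟩ ∧ m ∉ t ⟨p + 1, hp⟩ := by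
  obtain ⟨i, hi⟩ := h₁
  obtain ⟨j, hj⟩ := h₂
  by_contra! hno
  have key : ∀ n, ∀ hn : i.1 + n < l, m ∈ t ⟨i.1 + n, hn⟩ := by
    intro n
    induction n with
    | zero => exact fun _ => hi
    | succ n ih => exact fun hn => hno (i.1 + n) hn (ih (by omega))
  rcases le_total i j with h | h
  · have := key (j.1 - i.1) (by omega)
    simp only [Nat.add_sub_cancel' (show i.1 ≤ j.1 from h)] at this
    exact hj this
  · exact hj (ht.subset h hi)

/-- The halfspaces separating two vertices are covered by `D` chains. -/
theorem IsMedianGraph.exists_sepH_coloring {X : SimpleGraph V} (hX : IsMedianGraph X) {D : ℕ}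
    (hdim : DimLE X D) (x y : V) :
    ∃ c : Set V → ℕ, (∀ h ∈ sepH X x y, c h < D) ∧
      ∀ h ∈ sepH X x y, ∀ k ∈ sepH X x y, c h = c k → h ⊆ k ∨ k ⊆ h := by
  have hfin := hX.finite_sepH x y
  obtain ⟨c, hc, hcc⟩ := exists_chain_coloring hfin.toFinset D (by
    intro A hA hanti
    have hA' : ∀ h ∈ A, h ∈ sepH X x y := fun h hh => hfin.mem_toFinset.1 (hA hh)
    refine hdim A (fun h hh => (hA' h hh).1) fun h hh k hk hne => ?_
    obtain ⟨-, hy, hx⟩ := hA' h hh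
    obtain ⟨-, ky, kx⟩ := hA' k hk
    refine ⟨⟨y, hy, ky⟩, ?_, ?_, ⟨x, hx, kx⟩⟩
    · obtain ⟨v, hv, hv'⟩ := Set.not_subset.1 (hanti hk hh hne.symm)
      exact ⟨v, hv', hv⟩
    · obtain ⟨v, hv, hv'⟩ := Set.not_subset.1 (hanti hh hk hne)
      exact ⟨v, hv, hv'⟩)
  exact ⟨c, fun h hh => hc h (hfin.mem_toFinset.2 hh), fun h hh k hk =>
    hcc h (hfin.mem_toFinset.2 hh) k (hfin.mem_toFinset.2 hk)⟩

/-- Segments crossing `m` at the same step with comparable members form a staircase. -/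
theorem card_le_of_comparable {X : SimpleGraph V} {σ : ℕ} (hstair : StaircaseLE X σ) {l : ℕ}
    {x y m : V} {p : ℕ} (hp : p + 1 < l) (F : Finset (Fin l → Set V))
    (hseg : ∀ t ∈ F, IsHSegment X l t) (hin : ∀ t ∈ F, SegIn X x y t)
    (hc : ∀ t ∈ F, ∀ t' ∈ F, ∀ i, t i ⊆ t' i ∨ t' i ⊆ t i)
    (hm : ∀ t ∈ F, m ∈ t ⟨p, by omega⟩) (hm' : ∀ t ∈ F, m ∉ t ⟨p + 1, hp⟩) : F.card ≤ σ := by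
  classical
  by_contra! hcard
  have hpl : p < l := by omega
  have hinj : Set.InjOn (fun t : Fin l → Set V => t ⟨p, hpl⟩) F := fun t ht t' ht' h =>
    (hseg t ht).eq_of_apply_eq (hseg t' ht') (hc t ht t' ht') _ h
  obtain ⟨f, hf, hfF⟩ := exists_strictAnti_of_chain (F.image fun t => t ⟨p, hpl⟩) (by
    intro a ha b hb
    obtain ⟨t, ht, rfl⟩ := Finset.mem_image.1 ha
    obtain ⟨t', ht', rfl⟩ := Finset.mem_image.1 hb
    exact hc t ht t' ht' _) (n := σ + 1) (by rw [Finset.card_image_of_injOn hinj]; omega)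
  choose t htF htf using fun i => Finset.mem_image.1 (hfF i)
  have hlt : ∀ i j : Fin (σ + 1), i < j → t j ⟨p, hpl⟩ ⊂ t i ⟨p, hpl⟩ := by
    intro i j hij
    have := hf hij
    rwa [← htf i, ← htf j] at this
  have htight : ∀ i, TightlyNested X (t i ⟨p, hpl⟩) (t i ⟨p + 1, hp⟩) := fun i =>
    (hseg _ (htF i)).2 _ _ rfl
  have hnot : ∀ i j : Fin (σ + 1), i < j → ¬ t i ⟨p + 1, hp⟩ ⊂ t j ⟨p, hpl⟩ := fun i j hij h =>
    (htight i).2 ⟨_, (hseg _ (htF j)).1 _, hlt i j hij, h⟩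
  refine hstair (fun i => t i ⟨p, hpl⟩) (fun i => t i ⟨p + 1, hp⟩)
    ⟨fun i => (hseg _ (htF i)).1 _, fun i => (hseg _ (htF i)).1 _, hlt, ?_,
      fun i => (htight i).1, ?_⟩
  · intro i j hij
    have h₁ : ¬ t i ⟨p + 1, hp⟩ ⊆ t j ⟨p + 1, hp⟩ := fun h =>
      hnot i j hij (h.trans_ssubset (htight j).1)
    exact ⟨(hc _ (htF i) _ (htF j) _).resolve_left h₁, h₁⟩
  · intro i j hji
    obtain ⟨-, hy, hx⟩ := hin _ (htF i) ⟨p, hpl⟩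
    obtain ⟨-, ky, kx⟩ := hin _ (htF j) ⟨p + 1, hp⟩
    refine ⟨⟨y, hy, ky⟩, ?_, ⟨m, hm _ (htF i), hm' _ (htF j)⟩, ⟨x, hx, kx⟩⟩
    by_contra hne
    refine hnot j i hji ⟨fun v hv => ?_, fun h => hm' _ (htF j) (h (hm _ (htF i)))⟩
    by_contra hv'
    exact hne ⟨v, hv', hv⟩

/-- The number of segments in `[x,y]_H` having `m` in their interior is bounded. -/
theorem IsMedianGraph.card_crossing_le {X : SimpleGraph V} (hX : IsMedianGraph X) {D σ : ℕ}
    (hdim : DimLE X D) (hstair : StaircaseLE X σ) {l : ℕ} {x y m : V}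
    (T : Finset (Fin l → Set V)) (hseg : ∀ t ∈ T, IsHSegment X l t)
    (hin : ∀ t ∈ T, SegIn X x y t) (hm : ∀ t ∈ T, ∃ i, m ∈ t i)
    (hm' : ∀ t ∈ T, ∃ i, m ∉ t i) : T.card ≤ σ * ((l - 1) * D ^ l) := by
  classical
  obtain ⟨c, hc, hcc⟩ := hX.exists_sepH_coloring hdim x y
  choose! p hpl hp hp' using fun t ht => (hseg t ht).exists_crossing (hm t ht) (hm' t ht)
  have := Finset.card_le_mul_card_image_of_maps_to
    (f := fun t : Fin l → Set V => (p t, fun i => c (t i))) (s := T)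
    (t := Finset.range (l - 1) ×ˢ Fintype.piFinset fun _ : Fin l => Finset.range D) (by
      intro t ht
      simp only [Finset.mem_product, Finset.mem_range, Fintype.mem_piFinset]
      have := hpl t ht
      exact ⟨by omega, fun i => hc _ (hin t ht i)⟩) σ (by
      rintro ⟨q, b⟩ hb
      have hF : ∀ t ∈ T.filter (fun t => (p t, fun i => c (t i)) = (q, b)),
          t ∈ T ∧ p t = q ∧ ∀ i, c (t i) = b i := by
        intro t ht
        obtain ⟨h₁, h₂⟩ := Finset.mem_filter.1 ht
        rw [Prod.mk.injEq] at h₂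
        exact ⟨h₁, h₂.1, fun i => congrFun h₂.2 i⟩
      have hq : q + 1 < l := by
        have := Finset.mem_range.1 (Finset.mem_product.1 hb).1
        simp only at this
        omega
      refine card_le_of_comparable hstair (x := x) (y := y) (m := m) hq _
        (fun t ht => hseg t (hF t ht).1) (fun t ht => hin t (hF t ht).1)
        (fun t ht t' ht' i => ?_) (fun t ht => ?_) (fun t ht => ?_)
      · exact hcc _ (hin t (hF t ht).1 i) _ (hin t' (hF t' ht').1 i)
          (((hF t ht).2.2 i).trans ((hF t' ht').2.2 i).symm)
      · obtain ⟨h₁, rfl, -⟩ := hF t ht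
        exact hp t h₁
      · obtain ⟨h₁, rfl, -⟩ := hF t ht
        exact hp' t h₁)
  simpa using this

section Action

variable {Γ : Type*} [Group Γ] [MulAction Γ V] {X : SimpleGraph V}

theorem ActsOn.dist_smul (hact : ActsOn Γ X) (hX : X.Connected) (γ : Γ) (a b : V) :
    X.dist (γ • a) (γ • b) = X.dist a b := by
  have key : ∀ (γ : Γ) (a b : V), X.dist (γ • a) (γ • b) ≤ X.dist a b := by
    intro γ a b
    obtain ⟨p, hp⟩ := hX.exists_walk_length_eq_dist a b
    let f : X →g X := ⟨fun v => γ • v, fun h => hact γ _ _ h⟩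
    rw [← hp, ← SimpleGraph.Walk.length_map f p]
    exact X.dist_le (p.map f)
  refine le_antisymm (key γ a b) ?_
  simpa using key γ⁻¹ (γ • a) (γ • b)

theorem mem_smul_image (γ : Γ) (h : Set V) (v : V) :
    v ∈ (γ • ·) '' h ↔ γ⁻¹ • v ∈ h := by
  constructor
  · rintro ⟨w, hw, rfl⟩
    simpa using hw
  · intro hv
    exact ⟨_, hv, by simp⟩

theorem smul_image_inv (γ : Γ) (h : Set V) : (γ • ·) '' ((γ⁻¹ • ·) '' h) = h := by
  ext v
  simp

theorem smul_image_ssubset (γ : Γ) {h k : Set V} (hk : k ⊂ h) :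
    (γ • ·) '' k ⊂ (γ • ·) '' h :=
  (MulAction.injective γ).image_strictMono hk

theorem ActsOn.isHalfspace_smul (hact : ActsOn Γ X) (hX : X.Connected) (γ : Γ) {h : Set V}
    (hh : IsHalfspace X h) : IsHalfspace X ((γ • ·) '' h) := by
  obtain ⟨a, b, hab, rfl⟩ := hh
  refine ⟨γ • a, γ • b, hact γ a b hab, ?_⟩
  ext v
  rw [mem_smul_image, Set.mem_ofPred_eq, Set.mem_ofPred_eq,
    ← hact.dist_smul hX γ (γ⁻¹ • v) a, ← hact.dist_smul hX γ (γ⁻¹ • v) b, smul_inv_smul]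

theorem ActsOn.isHSegment_smul (hact : ActsOn Γ X) (hX : X.Connected) (γ : Γ) {l : ℕ}
    {s : Fin l → Set V} (hs : IsHSegment X l s) : IsHSegment X l (segSMul γ s) := by
  refine ⟨fun i => hact.isHalfspace_smul hX γ (hs.1 i), fun i j hij => ?_⟩
  obtain ⟨h₁, h₂⟩ := hs.2 i j hij
  refine ⟨smul_image_ssubset γ h₁, ?_⟩
  rintro ⟨h', hh', hlt, hgt⟩
  refine h₂ ⟨(γ⁻¹ • ·) '' h', hact.isHalfspace_smul hX γ⁻¹ hh', ?_, ?_⟩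
  · have := smul_image_ssubset γ⁻¹ hlt
    have e := smul_image_inv γ⁻¹ (s i)
    rw [inv_inv] at e
    simpa only [segSMul, e] using this
  · have := smul_image_ssubset γ⁻¹ hgt
    have e := smul_image_inv γ⁻¹ (s j)
    rw [inv_inv] at e
    simpa only [segSMul, e] using this

theorem segSMul_segSMul (γ γ' : Γ) {l : ℕ} (s : Fin l → Set V) :
    segSMul γ (segSMul γ' s) = segSMul (γ * γ') s := by
  funext i
  simp only [segSMul, Set.image_image, mul_smul]

theorem segSMul_injective (γ : Γ) {l : ℕ} :
    Function.Injective (segSMul γ : (Fin l → Set V) → Fin l → Set V) := by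
  intro t t' h
  funext i
  exact (Set.image_injective.2 (MulAction.injective γ)) (congrFun h i)

theorem ActsOn.segIn_smul (hact : ActsOn Γ X) (hX : X.Connected) (γ : Γ) {x y : V} {l : ℕ}
    {t : Fin l → Set V} (ht : SegIn X x y t) : SegIn X (γ • x) (γ • y) (segSMul γ t) := by
  intro i
  obtain ⟨h, hy, hx⟩ := ht i
  refine ⟨hact.isHalfspace_smul hX γ h, ⟨y, hy, rfl⟩, fun hx' => hx ?_⟩
  simpa using (mem_smul_image γ (t i) _).1 hx'

theorem ActsOn.translatesIn_smul (hact : ActsOn Γ X) (hX : X.Connected) (γ : Γ) {l : ℕ}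
    (s : Fin l → Set V) (x y : V) :
    translatesIn X Γ s (γ • x) (γ • y) = segSMul γ '' translatesIn X Γ s x y := by
  ext t
  constructor
  · rintro ⟨⟨δ, rfl⟩, ht⟩
    refine ⟨segSMul (γ⁻¹ * δ) s, ⟨⟨_, rfl⟩, ?_⟩, ?_⟩
    · rw [← segSMul_segSMul]
      simpa using hact.segIn_smul hX γ⁻¹ ht
    · rw [segSMul_segSMul, mul_inv_cancel_left]
  · rintro ⟨_, ⟨⟨δ, rfl⟩, ht⟩, rfl⟩
    exact ⟨⟨γ * δ, segSMul_segSMul γ δ s⟩, hact.segIn_smul hX γ ht⟩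

theorem ActsOn.fs_smul (hact : ActsOn Γ X) (hX : X.Connected) (γ : Γ) {l : ℕ}
    (s : Fin l → Set V) (x y : V) : fs X Γ s (γ • x) (γ • y) = fs X Γ s x y := by
  simp only [fs, hact.translatesIn_smul hX, Set.ncard_image_of_injective _ (segSMul_injective γ)]

/-- Counting translates is superadditive along geodesics, with bounded error. -/
theorem IsMedianGraph.ncard_translatesIn (hX : IsMedianGraph X) (hact : ActsOn Γ X) {D σ : ℕ}
    (hdim : DimLE X D) (hstair : StaircaseLE X σ) {l : ℕ} (hl : 1 ≤ l) {s : Fin l → Set V}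
    (hs : IsHSegment X l s) {x y m : V} (hm : X.dist x m + X.dist m y = X.dist x y) :
    (translatesIn X Γ s x m).ncard + (translatesIn X Γ s m y).ncard ≤
        (translatesIn X Γ s x y).ncard ∧
      (translatesIn X Γ s x y).ncard ≤ (translatesIn X Γ s x m).ncard +
        (translatesIn X Γ s m y).ncard + σ * ((l - 1) * D ^ l) := by
  have hfin : ∀ x y : V, (translatesIn X Γ s x y).Finite := fun x y =>
    (Set.Finite.pi' fun _ : Fin l => hX.finite_sepH x y).subset fun t ht => ht.2
  have hunion := hX.sepH_eq_union hm
  have hsub : translatesIn X Γ s x m ∪ translatesIn X Γ s m y ⊆ translatesIn X Γ s x y := by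
    rintro t (⟨ht, hin⟩ | ⟨ht, hin⟩)
    · exact ⟨ht, fun i => hunion ▸ Or.inl (hin i)⟩
    · exact ⟨ht, fun i => hunion ▸ Or.inr (hin i)⟩
  have hdisj : Disjoint (translatesIn X Γ s x m) (translatesIn X Γ s m y) := by
    rw [Set.disjoint_left]
    intro t ht ht'
    exact (ht'.2 ⟨0, hl⟩).2.2 (ht.2 ⟨0, hl⟩).2.1
  have hadd := Set.ncard_sdiff_add_ncard_of_subset hsub (hfin x y)
  rw [Set.ncard_union_eq hdisj (hfin x m) (hfin m y)] at hadd
  have hIfin : (translatesIn X Γ s x y \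
      (translatesIn X Γ s x m ∪ translatesIn X Γ s m y)).Finite := (hfin x y).subset Set.sdiff_subset
  have hI := hX.card_crossing_le hdim hstair (x := x) (y := y) (m := m) hIfin.toFinset
    (fun t ht => by
      obtain ⟨⟨⟨γ, rfl⟩, -⟩, -⟩ := hIfin.mem_toFinset.1 ht
      exact hact.isHSegment_smul hX.1 γ hs)
    (fun t ht => (hIfin.mem_toFinset.1 ht).1.2)
    (fun t ht => by
      obtain ⟨⟨h₁, h₂⟩, h₃⟩ := hIfin.mem_toFinset.1 ht
      by_contra! hno
      exact h₃ (Or.inr ⟨h₁, fun i => ⟨(h₂ i).1, (h₂ i).2.1, hno i⟩⟩))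
    (fun t ht => by
      obtain ⟨⟨h₁, h₂⟩, h₃⟩ := hIfin.mem_toFinset.1 ht
      by_contra! hno
      exact h₃ (Or.inl ⟨h₁, fun i => ⟨(h₂ i).1, hno i, (h₂ i).2.2⟩⟩))
  rw [← Set.ncard_eq_toFinset_card _ hIfin] at hI
  omega

/-- Along a geodesic through `m`, the median quasimorphism is additive up to a bounded error. -/
theorem IsMedianGraph.abs_fs_sub_le (hX : IsMedianGraph X) (hact : ActsOn Γ X) {D σ : ℕ}
    (hdim : DimLE X D) (hstair : StaircaseLE X σ) {l : ℕ} (hl : 1 ≤ l) {s : Fin l → Set V}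
    (hs : IsHSegment X l s) {x y m : V} (hm : X.dist x m + X.dist m y = X.dist x y) :
    |fs X Γ s x y - fs X Γ s x m - fs X Γ s m y| ≤ ((l : ℝ) - 1) * σ * (D : ℝ) ^ l := by
  obtain ⟨h₁, h₂⟩ := hX.ncard_translatesIn hact hdim hstair hl hs hm
  obtain ⟨h₃, h₄⟩ := hX.ncard_translatesIn hact hdim hstair hl hs (x := y) (y := x) (m := m) (by
    rw [X.dist_comm (u := y) (v := m), X.dist_comm (u := m) (v := x), X.dist_comm (u := y), ← hm,
      add_comm])
  have e : ((σ * ((l - 1) * D ^ l) : ℕ) : ℝ) = ((l : ℝ) - 1) * σ * (D : ℝ) ^ l := by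
    push_cast [hl]
    ring
  rw [← e]
  simp only [fs]
  rify at h₁ h₂ h₃ h₄ ⊢
  rw [abs_le]
  constructor <;> linarith

end Action

/-- defect estimate: for a median graph of dimension at most `D` and
staircase length at most `σ`, with a group acting by graph automorphisms and an
H-segment `s` of length `l ≥ 1`, the coboundary of the median quasimorphism `f_s` is
bounded: `|f_s(y,z) − f_s(x,z) + f_s(x,y)| ≤ 3·(l−1)·σ·D^l`. In particular `f_s` is a
quasimorphism of the action `Γ ↷ X` (it is Γ-invariant with finite defect). -/
theorem statement0 {V : Type*} (X : SimpleGraph V) (D σ : ℕ)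
    (hmed : IsMedianGraph X) (hdim : DimLE X D) (hstair : StaircaseLE X σ)
    (Γ : Type*) [Group Γ] [MulAction Γ V] (hact : ActsOn Γ X)
    (l : ℕ) (hl : 1 ≤ l) (s : Fin l → Set V) (hseg : IsHSegment X l s) :
    (∀ x y z : V,
      |fs X Γ s y z - fs X Γ s x z + fs X Γ s x y| ≤
        3 * ((l : ℝ) - 1) * (σ : ℝ) * (D : ℝ) ^ l) ∧
    (∀ (γ : Γ) (x y : V), fs X Γ s (γ • x) (γ • y) = fs X Γ s x y) := by
  refine ⟨fun x y z => ?_, fun γ x y => hact.fs_smul hmed.1 γ s x y⟩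
  obtain ⟨m, h₁, h₂, h₃⟩ := hmed.exists_median x y z
  have b₁ := abs_le.1 (hmed.abs_fs_sub_le hact hdim hstair hl hseg h₁)
  have b₂ := abs_le.1 (hmed.abs_fs_sub_le hact hdim hstair hl hseg h₂)
  have b₃ := abs_le.1 (hmed.abs_fs_sub_le hact hdim hstair hl hseg h₃)
  have anti : ∀ u v : V, fs X Γ s u v = -fs X Γ s v u := fun u v => by simp [fs]
  have a := anti m y
  rw [abs_le]
  constructor <;> linarith

end MedianQM
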